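/- Assume V_m ⊆ H and f ∈ H. Assume (x_1,…,x_n) is drawn from ν^{⊗n} with ν = wμ, where w = α·w_m + (1−α)·h for some 0 < α < 1. If 0 < δ < 1, 0 < η < 1 and n ≥ c_δ^{-1} α^{-1} m log(m η^{-1}), then with probability at least 1−η the weighted least-squares projection f̂_m satisfies ‖f − f̂_m‖ ≤ (C_H + (1−δ)^{-1/2}(1−α)^{-1/2}) · inf_{g ∈ V_m} ‖f − g‖_H. -/

import Mathlib

open MeasureTheory ProbabilityTheory Matrix Finset
open scoped ENNReal NNReal BigOperators RealInnerProductSpace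

noncomputable section

namespace WLSDPP

variable {𝓧 : Type*} [MeasurableSpace 𝓧]

/-- Smallest eigenvalue of a real symmetric matrix, via the Rayleigh quotient. -/
def lambdaMin {m : ℕ} (A : Matrix (Fin m) (Fin m) ℝ) : ℝ :=
  ⨅ v : {v : Fin m → ℝ // ∑ i, v i ^ 2 = 1}, (v : Fin m → ℝ) ⬝ᵥ A.mulVec v

/-- The feature vector `𝛗(x) = (φ₁(x),…,φ_m(x))ᵀ`. -/
def feat {m : ℕ} (φ : Fin m → 𝓧 → ℝ) (x : 𝓧) : Fin m → ℝ := fun j => φ j x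

/-- Empirical Gram matrix `G^w(x) = (1/n) ∑ᵢ w(xᵢ)⁻¹ 𝛗(xᵢ)𝛗(xᵢ)ᵀ`. -/
def gram {m n : ℕ} (φ : Fin m → 𝓧 → ℝ) (w : 𝓧 → ℝ) (x : Fin n → 𝓧) :
    Matrix (Fin m) (Fin m) ℝ :=
  (n : ℝ)⁻¹ • ∑ i, (w (x i))⁻¹ • vecMulVec (feat φ (x i)) (feat φ (x i))

/-- Empirical seminorm squared `‖f‖ₙ² = (1/n) ∑ᵢ w(xᵢ)⁻¹ f(xᵢ)²`. -/
def empSq {n : ℕ} (w : 𝓧 → ℝ) (f : 𝓧 → ℝ) (x : Fin n → 𝓧) : ℝ :=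
  (n : ℝ)⁻¹ * ∑ i, (w (x i))⁻¹ * f (x i) ^ 2

/-- Squared L²(μ) norm. -/
def l2Sq (μ : Measure 𝓧) (f : 𝓧 → ℝ) : ℝ := ∫ y, f y ^ 2 ∂μ

/-- L²(μ) norm. -/
def l2 (μ : Measure 𝓧) (f : 𝓧 → ℝ) : ℝ := Real.sqrt (l2Sq μ f)

/-- The element of `V_m` with coefficient vector `a`. -/
def lin {m : ℕ} (φ : Fin m → 𝓧 → ℝ) (a : Fin m → ℝ) : 𝓧 → ℝ := fun y => ∑ j, a j * φ j y

/-- The L²(μ)-orthogonal projection onto `V_m` (for `φ` an orthonormal basis of `V_m`). -/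
def projV {m : ℕ} (μ : Measure 𝓧) (φ : Fin m → 𝓧 → ℝ) (f : 𝓧 → ℝ) : 𝓧 → ℝ :=
  lin φ (fun j => ∫ y, φ j y * f y ∂μ)

/-- The right-hand side vector `b = (1/n) ∑ᵢ w(xᵢ)⁻¹ f(xᵢ) 𝛗(xᵢ)`. -/
def bVec {m n : ℕ} (φ : Fin m → 𝓧 → ℝ) (w : 𝓧 → ℝ) (f : 𝓧 → ℝ) (x : Fin n → 𝓧) :
    Fin m → ℝ :=
  (n : ℝ)⁻¹ • ∑ i, ((w (x i))⁻¹ * f (x i)) • feat φ (x i)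

/-- The weighted least-squares projection `P̂_{V_m} f = 𝛗(·)ᵀ (G^w)⁻¹ b`. -/
def lsProj {m n : ℕ} (φ : Fin m → 𝓧 → ℝ) (w : 𝓧 → ℝ) (f : 𝓧 → ℝ) (x : Fin n → 𝓧) :
    𝓧 → ℝ :=
  lin φ ((gram φ w x)⁻¹ *ᵥ bVec φ w f x)

/-- The measure with density `w` with respect to `μ`. -/
def dens (μ : Measure 𝓧) (w : 𝓧 → ℝ) : Measure 𝓧 :=
  μ.withDensity fun a => ENNReal.ofReal (w a)

/-- The inverse Christoffel density `w_m(x) = (1/m) ‖𝛗(x)‖₂²`. -/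
def wChr {m : ℕ} (φ : Fin m → 𝓧 → ℝ) : 𝓧 → ℝ := fun x => (m : ℝ)⁻¹ * ∑ i, φ i x ^ 2

/-- The feature matrix `Φ(x)` with `i`-th row `𝛗(xᵢ)ᵀ`. -/
def featM {m n : ℕ} (φ : Fin m → 𝓧 → ℝ) (x : Fin n → 𝓧) : Matrix (Fin n) (Fin m) ℝ :=
  Matrix.of fun i j => φ j (x i)

/-- The weighted feature matrix `Φ^w(x)` with `i`-th row `w(xᵢ)^{-1/2} 𝛗(xᵢ)ᵀ`. -/
def featW {m n : ℕ} (φ : Fin m → 𝓧 → ℝ) (w : 𝓧 → ℝ) (x : Fin n → 𝓧) :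
    Matrix (Fin n) (Fin m) ℝ :=
  Matrix.of fun i j => (Real.sqrt (w (x i)))⁻¹ * φ j (x i)

/-- The projection DPP `γ_m`, with density `(1/m!) det(Φ(x)ᵀΦ(x))` w.r.t. `μ^⊗m`. -/
def dpp {m : ℕ} (μ : Measure 𝓧) (φ : Fin m → 𝓧 → ℝ) : Measure (Fin m → 𝓧) :=
  (Measure.pi fun _ : Fin m => μ).withDensity fun x =>
    ENNReal.ofReal ((m.factorial : ℝ)⁻¹ * ((featM φ x)ᵀ * featM φ x).det)

/-- The generalized volume sampling distribution `γ_n^ν`, `ν = wμ`, with density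
`n^m ((n−m)!/n!) det(G^w(x))` with respect to `ν^⊗n`. -/
def vs {m : ℕ} (μ : Measure 𝓧) (φ : Fin m → 𝓧 → ℝ) (w : 𝓧 → ℝ) (n : ℕ) :
    Measure (Fin n → 𝓧) :=
  (Measure.pi fun _ : Fin n => dens μ w).withDensity fun x =>
    ENNReal.ofReal ((n : ℝ) ^ m * ((n - m).factorial : ℝ) / (n.factorial : ℝ) *
      (gram φ w x).det)

/-- `c_δ = δ + (1−δ) log(1−δ)`. -/
def cDelta (δ : ℝ) : ℝ := δ + (1 - δ) * Real.log (1 - δ)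

/-- `φ₁, …, φ_m` is an orthonormal system in `L²_μ`. -/
def IsONB {m : ℕ} (μ : Measure 𝓧) (φ : Fin m → 𝓧 → ℝ) : Prop :=
  ∀ i j, ∫ y, φ i y * φ j y ∂μ = if i = j then (1 : ℝ) else 0

end WLSDPP

namespace WLSDPP

/-- Orthonormal diagonalization of a real symmetric matrix, read off on quadratic forms of powers
and on traces of powers. -/
lemma exists_spectral_moments {m : ℕ} {M : Matrix (Fin m) (Fin m) ℝ} (hM : M.IsHermitian) :
    ∃ (l : Fin m → ℝ) (U : Matrix (Fin m) (Fin m) ℝ),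
      (∀ (j : ℕ) (v : Fin m → ℝ), v ⬝ᵥ (M ^ j) *ᵥ v = ∑ a, (U *ᵥ v) a ^ 2 * l a ^ j) ∧
      (∀ j : ℕ, (M ^ j).trace = ∑ a, l a ^ j) ∧
      ∀ a, ∃ u : Fin m → ℝ, u ⬝ᵥ u = 1 ∧ u ⬝ᵥ M *ᵥ u = l a := by
  obtain ⟨V, l, h1, h3⟩ : ∃ (V : Matrix (Fin m) (Fin m) ℝ) (l : Fin m → ℝ),
      Vᵀ * V = 1 ∧ M = V * diagonal l * Vᵀ := by
    refine ⟨hM.eigenvectorUnitary, hM.eigenvalues, ?_, ?_⟩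
    · simpa [Matrix.star_eq_conjTranspose] using Unitary.coe_star_mul_self hM.eigenvectorUnitary
    · have := hM.spectral_theorem
      rw [Unitary.conjStarAlgAut_apply] at this
      simpa [Matrix.star_eq_conjTranspose, Function.comp_def] using this
  have h2 : V * Vᵀ = 1 := mul_eq_one_comm.mp h1
  have h4 : ∀ j : ℕ, M ^ j = V * diagonal (fun a => l a ^ j) * Vᵀ := by
    intro j
    induction j with
    | zero => simp [h2]
    | succ j ih =>
      rw [pow_succ, ih]
      conv_lhs => rw [h3]
      calc _ = V * diagonal (fun a => l a ^ j) * (Vᵀ * V) *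
              diagonal l * Vᵀ := by simp only [Matrix.mul_assoc]
        _ = _ := by
          rw [h1, Matrix.mul_one, Matrix.mul_assoc V, diagonal_mul_diagonal]
          simp [pow_succ]
  have h5 : ∀ (j : ℕ) (v : Fin m → ℝ),
      v ⬝ᵥ (M ^ j) *ᵥ v = ∑ a, (Vᵀ *ᵥ v) a ^ 2 * l a ^ j := by
    intro j v
    rw [h4, ← mulVec_mulVec, ← mulVec_mulVec, dotProduct_mulVec, ← mulVec_transpose]
    simp only [dotProduct, mulVec_diagonal]
    exact Finset.sum_congr rfl fun a _ => by ring
  refine ⟨l, Vᵀ, h5, ?_, ?_⟩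
  · intro j
    rw [h4, Matrix.trace_mul_comm, ← Matrix.mul_assoc, h1, Matrix.one_mul, trace_diagonal]
  · intro a
    have h6 : Vᵀ *ᵥ (V *ᵥ Pi.single a 1) = Pi.single a 1 := by
      rw [mulVec_mulVec, h1, one_mulVec]
    refine ⟨V *ᵥ Pi.single a 1, ?_, ?_⟩
    · have := h5 0 (V *ᵥ Pi.single a 1)
      rw [h6] at this
      simpa [Pi.single_apply] using this
    · have := h5 1 (V *ᵥ Pi.single a 1)
      rw [h6] at this
      simpa [Pi.single_apply] using this

lemma hasDerivAt_pow_sub_smul {m : ℕ} (C V : Matrix (Fin m) (Fin m) ℝ) (t : ℝ) (N : ℕ)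
    (i j : Fin m) :
    HasDerivAt (fun t : ℝ => ((C - t • V) ^ N) i j)
      (-(∑ k ∈ range N, (C - t • V) ^ k * V * (C - t • V) ^ (N - 1 - k)) i j) t := by
  induction N generalizing i j with
  | zero => simpa using hasDerivAt_const t _
  | succ N ih =>
    have h1 : ∀ l, HasDerivAt (fun t : ℝ => (C - t • V) l j) (-V l j) t := by
      intro l
      have := ((hasDerivAt_id t).mul_const (V l j)).const_sub (C l j)
      simpa using this
    have h2 := HasDerivAt.fun_sum (u := Finset.univ) fun l _ => (ih i l).mul (h1 l)
    have h3 : ∑ k ∈ range (N + 1), (C - t • V) ^ k * V * (C - t • V) ^ (N + 1 - 1 - k) =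
        (∑ k ∈ range N, (C - t • V) ^ k * V * (C - t • V) ^ (N - 1 - k)) * (C - t • V) +
          (C - t • V) ^ N * V := by
      rw [sum_range_succ, Finset.sum_mul]
      congr 1
      · refine Finset.sum_congr rfl fun k hk => ?_
        rw [Matrix.mul_assoc _ _ (C - t • V), ← pow_succ]
        have := Finset.mem_range.mp hk
        congr 2
        omega
      · simp
    rw [h3]
    refine h2.congr_deriv ?_
    simp only [Matrix.add_apply, Matrix.mul_apply, ← Finset.sum_add_distrib, neg_add,
      ← Finset.sum_neg_distrib]
    exact Finset.sum_congr rfl fun l _ => by ring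

/-- Chebyshev-type inequality for the moments of a symmetric matrix bounded below. -/
lemma moment_mul_moment_le {m : ℕ} {M : Matrix (Fin m) (Fin m) ℝ} (hM : M.IsHermitian)
    {lo R : ℝ} (hlo : 0 < lo) (hlow : ∀ u : Fin m → ℝ, lo * (u ⬝ᵥ u) ≤ u ⬝ᵥ M *ᵥ u)
    {v : Fin m → ℝ} (hv : v ⬝ᵥ v ≤ R) (j k : ℕ) :
    (v ⬝ᵥ (M ^ j) *ᵥ v) * (v ⬝ᵥ (M ^ k) *ᵥ v) ≤ R / lo * (v ⬝ᵥ (M ^ (j + k + 1)) *ᵥ v) := by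
  obtain ⟨l, U, h1, -, h3⟩ := exists_spectral_moments hM
  have hl : ∀ a, lo ≤ l a := by
    intro a
    obtain ⟨u, hu, hu'⟩ := h3 a
    have := hlow u
    rw [hu, hu'] at this
    linarith
  have h0 : v ⬝ᵥ v = ∑ a, (U *ᵥ v) a ^ 2 := by simpa using h1 0 v
  rw [h1, h1, h1]
  rw [h0] at hv
  set p : Fin m → ℝ := fun a => (U *ᵥ v) a ^ 2 with hp
  have hp0 : ∀ a, 0 ≤ p a := fun a => sq_nonneg _
  change (∑ a, p a * l a ^ j) * (∑ a, p a * l a ^ k) ≤ R / lo * ∑ a, p a * l a ^ (j + k + 1)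
  have hq0 : 0 ≤ ∑ a, p a * l a ^ (j + k) :=
    Finset.sum_nonneg fun a _ => mul_nonneg (hp0 a) (pow_nonneg (hlo.le.trans (hl a)) _)
  have hcheb : (∑ a, p a * l a ^ j) * (∑ a, p a * l a ^ k) ≤
      (∑ a, p a) * ∑ a, p a * l a ^ (j + k) := by
    have key : 0 ≤ ∑ a, ∑ b, p a * p b * ((l a ^ j - l b ^ j) * (l a ^ k - l b ^ k)) := by
      refine Finset.sum_nonneg fun a _ => Finset.sum_nonneg fun b _ => ?_
      refine mul_nonneg (mul_nonneg (hp0 a) (hp0 b)) ?_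
      have ha := hlo.le.trans (hl a)
      have hb := hlo.le.trans (hl b)
      rcases le_total (l a) (l b) with h | h
      · exact mul_nonneg_of_nonpos_of_nonpos (sub_nonpos.mpr (pow_le_pow_left₀ ha h _))
          (sub_nonpos.mpr (pow_le_pow_left₀ ha h _))
      · exact mul_nonneg (sub_nonneg.mpr (pow_le_pow_left₀ hb h _))
          (sub_nonneg.mpr (pow_le_pow_left₀ hb h _))
    have expand : ∑ a, ∑ b, p a * p b * ((l a ^ j - l b ^ j) * (l a ^ k - l b ^ k)) =
        2 * ((∑ a, p a) * ∑ a, p a * l a ^ (j + k)) -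
          2 * ((∑ a, p a * l a ^ j) * (∑ a, p a * l a ^ k)) := by
      have e1 : (∑ a, p a) * ∑ a, p a * l a ^ (j + k) =
          ∑ a, ∑ b, p a * (p b * l b ^ (j + k)) := Finset.sum_mul_sum ..
      have e2 : (∑ a, p a) * ∑ a, p a * l a ^ (j + k) =
          ∑ a, ∑ b, p a * l a ^ (j + k) * p b := by rw [mul_comm]; exact Finset.sum_mul_sum ..
      have e3 : (∑ a, p a * l a ^ j) * (∑ a, p a * l a ^ k) =
          ∑ a, ∑ b, p a * l a ^ j * (p b * l b ^ k) := Finset.sum_mul_sum ..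
      have e4 : (∑ a, p a * l a ^ j) * (∑ a, p a * l a ^ k) =
          ∑ a, ∑ b, p a * l a ^ k * (p b * l b ^ j) := by rw [mul_comm]; exact Finset.sum_mul_sum ..
      rw [two_mul, two_mul]
      nth_rewrite 1 [e1]
      rw [e2]
      nth_rewrite 1 [e3]
      rw [e4]
      simp only [← Finset.sum_add_distrib, ← Finset.sum_sub_distrib]
      exact Finset.sum_congr rfl fun a _ => Finset.sum_congr rfl fun b _ => by ring
    linarith
  have hstep : ∑ a, p a * l a ^ (j + k) ≤ lo⁻¹ * ∑ a, p a * l a ^ (j + k + 1) := by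
    rw [Finset.mul_sum]
    refine Finset.sum_le_sum fun a _ => ?_
    have : 1 ≤ lo⁻¹ * l a := by
      rw [inv_mul_eq_div, one_le_div hlo]; exact hl a
    have h' : 0 ≤ p a * l a ^ (j + k) := mul_nonneg (hp0 a) (pow_nonneg (hlo.le.trans (hl a)) _)
    calc p a * l a ^ (j + k) ≤ p a * l a ^ (j + k) * (lo⁻¹ * l a) := le_mul_of_one_le_right h' this
      _ = _ := by ring
  have hR : 0 ≤ R := (Finset.sum_nonneg fun a _ => hp0 a).trans hv
  calc _ ≤ _ := hcheb
    _ ≤ R * ∑ a, p a * l a ^ (j + k) := mul_le_mul_of_nonneg_right hv hq0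
    _ ≤ R * (lo⁻¹ * ∑ a, p a * l a ^ (j + k + 1)) := mul_le_mul_of_nonneg_left hstep hR
    _ = _ := by ring

lemma trace_pow_mul_vecMulVec {m : ℕ} (M : Matrix (Fin m) (Fin m) ℝ) (v : Fin m → ℝ) (j k : ℕ) :
    (M ^ j * vecMulVec v v * M ^ k).trace = v ⬝ᵥ (M ^ (j + k)) *ᵥ v := by
  rw [Matrix.trace_mul_comm, ← Matrix.mul_assoc, ← pow_add, mul_vecMulVec, trace_vecMulVec,
    dotProduct_comm, add_comm]

lemma dotProduct_pow_mul_vecMulVec {m : ℕ} (M : Matrix (Fin m) (Fin m) ℝ) (v : Fin m → ℝ)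
    (j k : ℕ) :
    v ⬝ᵥ (M ^ j * vecMulVec v v * M ^ k) *ᵥ v =
      (v ⬝ᵥ (M ^ j) *ᵥ v) * (v ⬝ᵥ (M ^ k) *ᵥ v) := by
  rw [← mulVec_mulVec, ← mulVec_mulVec, vecMulVec_mulVec, mulVec_smul, dotProduct_smul]
  simp

/-- A rank-one Golden–Thompson type inequality for high powers in place of the exponential. -/
lemma trace_pow_sub_rankOne_le {m : ℕ} {C : Matrix (Fin m) (Fin m) ℝ} (hC : C.IsHermitian)
    {v : Fin m → ℝ} {lo R T : ℝ} (hlo : 0 < lo) (hR : 0 < R) (hT : 0 ≤ T)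
    (hlow : ∀ u : Fin m → ℝ, lo * (u ⬝ᵥ u) ≤ u ⬝ᵥ (C - T • vecMulVec v v) *ᵥ u)
    (hv : v ⬝ᵥ v ≤ R) (p : ℕ) :
    ((C - T • vecMulVec v v) ^ (p + 1)).trace ≤ (C ^ (p + 1)).trace -
      lo / R * (1 - Real.exp (-((p + 1) * T * R / lo))) * (v ⬝ᵥ (C ^ p) *ᵥ v) := by
  set V := vecMulVec v v with hV
  set M : ℝ → Matrix (Fin m) (Fin m) ℝ := fun t => C - t • V with hMdef
  set g : ℝ → ℝ := fun t => v ⬝ᵥ (M t ^ p) *ᵥ v with hg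
  set c : ℝ := (p + 1) * (R / lo) with hc
  have hc0 : 0 < c := by positivity
  have hherm : ∀ t, (M t).IsHermitian := by
    intro t
    refine hC.sub ?_
    rw [Matrix.IsHermitian, conjTranspose_eq_transpose_of_trivial, transpose_smul, hV,
      transpose_vecMulVec]
  have hquad : ∀ t (u : Fin m → ℝ), u ⬝ᵥ (M t) *ᵥ u = u ⬝ᵥ C *ᵥ u - t * (v ⬝ᵥ u) ^ 2 := by
    intro t u
    simp only [hMdef, hV, sub_mulVec, smul_mulVec, vecMulVec_mulVec, dotProduct_sub,
      dotProduct_smul, dotProduct_comm u v, op_smul_eq_smul, smul_eq_mul]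
    ring
  have hlowt : ∀ t ≤ T, ∀ u : Fin m → ℝ, lo * (u ⬝ᵥ u) ≤ u ⬝ᵥ (M t) *ᵥ u := by
    intro t ht u
    refine (hlow u).trans ?_
    change u ⬝ᵥ (M T) *ᵥ u ≤ _
    rw [hquad, hquad]
    nlinarith [sq_nonneg (v ⬝ᵥ u)]
  have htr : ∀ t, HasDerivAt (fun t => (M t ^ (p + 1)).trace) (-((p + 1) * g t)) t := by
    intro t
    have := HasDerivAt.fun_sum (u := Finset.univ) fun i _ =>
      hasDerivAt_pow_sub_smul C V t (p + 1) i i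
    refine this.congr_deriv ?_
    rw [Finset.sum_neg_distrib]
    change -(∑ k ∈ range (p + 1), (C - t • V) ^ k * V * (C - t • V) ^ (p + 1 - 1 - k)).trace = _
    rw [trace_sum]
    congr 1
    rw [Finset.sum_congr rfl (g := fun _ => g t)]
    · simp
    · intro k hk
      have := Finset.mem_range.mp hk
      rw [trace_pow_mul_vecMulVec]
      simp only [hg, hMdef]
      congr 3
      omega
  have hgd : ∀ t, HasDerivAt g
      (-∑ k ∈ range p, (v ⬝ᵥ (M t ^ k) *ᵥ v) * (v ⬝ᵥ (M t ^ (p - 1 - k)) *ᵥ v)) t := by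
    intro t
    have := HasDerivAt.fun_sum (u := Finset.univ) fun i _ =>
      (HasDerivAt.fun_sum (u := Finset.univ) fun j _ =>
        (hasDerivAt_pow_sub_smul C V t p i j).mul_const (v j)).const_mul (v i)
    refine this.congr_deriv ?_
    simp_rw [neg_mul, Finset.sum_neg_distrib, mul_neg, Finset.sum_neg_distrib]
    change -(v ⬝ᵥ (∑ k ∈ range p, (C - t • V) ^ k * V * (C - t • V) ^ (p - 1 - k)) *ᵥ v) = _
    rw [sum_mulVec, dotProduct_sum]
    simp_rw [hV, dotProduct_pow_mul_vecMulVec]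
    rfl
  have hg0 : ∀ t ≤ T, 0 ≤ g t := by
    intro t ht
    obtain ⟨l, U, h1, -, h3⟩ := exists_spectral_moments (hherm t)
    simp only [hg, h1]
    refine Finset.sum_nonneg fun a _ => mul_nonneg (sq_nonneg _) (pow_nonneg ?_ _)
    obtain ⟨u, hu, hu'⟩ := h3 a
    have := hlowt t ht u
    rw [hu, hu'] at this
    linarith
  have hgd' : ∀ t ≤ T,
      ∑ k ∈ range p, (v ⬝ᵥ (M t ^ k) *ᵥ v) * (v ⬝ᵥ (M t ^ (p - 1 - k)) *ᵥ v) ≤ c * g t := by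
    intro t ht
    have : ∑ k ∈ range p, (v ⬝ᵥ (M t ^ k) *ᵥ v) * (v ⬝ᵥ (M t ^ (p - 1 - k)) *ᵥ v) ≤
        ∑ _k ∈ range p, R / lo * g t := by
      refine Finset.sum_le_sum fun k hk => ?_
      have hk := Finset.mem_range.mp hk
      refine (moment_mul_moment_le (hherm t) hlo (hlowt t ht) hv k (p - 1 - k)).trans_eq ?_
      rw [show k + (p - 1 - k) + 1 = p by omega]
    refine this.trans ?_
    have h' : 0 ≤ R / lo * g t := mul_nonneg (by positivity) (hg0 t ht)
    simp only [sum_const, card_range, nsmul_eq_mul, hc]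
    nlinarith
  have hmono : MonotoneOn (fun t => g t * Real.exp (c * t)) (Set.Icc 0 T) := by
    have hd : ∀ t, HasDerivAt (fun t => g t * Real.exp (c * t)) _ t := fun t =>
      (hgd t).mul (((hasDerivAt_id t).const_mul c).exp)
    refine monotoneOn_of_deriv_nonneg (convex_Icc 0 T)
      (fun t _ => (hd t).continuousAt.continuousWithinAt)
      (fun t _ => (hd t).differentiableAt.differentiableWithinAt) fun t ht => ?_
    rw [interior_Icc] at ht
    rw [(hd t).deriv]
    have := hgd' t ht.2.le
    have := mul_le_mul_of_nonneg_right this (Real.exp_pos (c * t)).le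
    simp only [id, mul_one]
    linarith
  have hgexp : ∀ t ∈ Set.Icc 0 T, g 0 * Real.exp (-(c * t)) ≤ g t := by
    intro t ht
    have := hmono ⟨le_rfl, hT⟩ ht ht.1
    simp only [mul_zero, Real.exp_zero, mul_one] at this
    rw [Real.exp_neg, ← div_eq_mul_inv, div_le_iff₀ (Real.exp_pos _)]
    exact this
  have hanti : AntitoneOn
      (fun t => (M t ^ (p + 1)).trace + (p + 1) * g 0 / c * (1 - Real.exp (-(c * t))))
      (Set.Icc 0 T) := by
    have hd : ∀ t, HasDerivAt
        (fun t => (M t ^ (p + 1)).trace + (p + 1) * g 0 / c * (1 - Real.exp (-(c * t)))) _ t :=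
      fun t => (htr t).add
        (((((hasDerivAt_id t).const_mul c).neg).exp.const_sub 1).const_mul ((p + 1) * g 0 / c))
    refine antitoneOn_of_deriv_nonpos (convex_Icc 0 T)
      (fun t _ => (hd t).continuousAt.continuousWithinAt)
      (fun t _ => (hd t).differentiableAt.differentiableWithinAt) fun t ht => ?_
    rw [interior_Icc] at ht
    rw [(hd t).deriv]
    have h1 := hgexp t ⟨ht.1.le, ht.2.le⟩
    have h2 : ((p : ℝ) + 1) * g 0 / c * (-(Real.exp (-(c * t)) * -(c * 1))) =
        (p + 1) * (g 0 * Real.exp (-(c * t))) := by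
      field_simp
    simp only [Pi.neg_apply, id]
    rw [h2]
    have : (0 : ℝ) ≤ p + 1 := by positivity
    nlinarith
  have := hanti ⟨le_rfl, hT⟩ ⟨hT, le_rfl⟩ hT
  have hM0 : M 0 = C := by simp [hMdef]
  simp only [hM0, mul_zero, neg_zero, Real.exp_zero, sub_self, add_zero] at this
  have e1 : c * T = (p + 1) * T * R / lo := by rw [hc]; ring
  have e2 : ((p : ℝ) + 1) * g 0 / c = lo / R * (v ⬝ᵥ (C ^ p) *ᵥ v) := by
    simp only [hg, hM0, hc]
    field_simp
  rw [e1, e2] at this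
  change (M T ^ (p + 1)).trace ≤ _
  linarith

/-- The matrix `1 - s ∑ᵢ v(xᵢ)v(xᵢ)ᵀ`. -/
def shrunk {𝓧 : Type*} {m k : ℕ} (v : 𝓧 → Fin m → ℝ) (s : ℝ) (x : Fin k → 𝓧) :
    Matrix (Fin m) (Fin m) ℝ :=
  1 - s • ∑ i, vecMulVec (v (x i)) (v (x i))

section Shrunk

variable {𝓧 : Type*} {m k : ℕ} (v : 𝓧 → Fin m → ℝ) (s : ℝ)

lemma shrunk_isHermitian (x : Fin k → 𝓧) : (shrunk v s x).IsHermitian := by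
  simp [shrunk, Matrix.IsHermitian, conjTranspose_eq_transpose_of_trivial, transpose_sub,
    transpose_smul, transpose_sum, transpose_vecMulVec]

lemma shrunk_quadForm (x : Fin k → 𝓧) (u : Fin m → ℝ) :
    u ⬝ᵥ shrunk v s x *ᵥ u = u ⬝ᵥ u - s * ∑ i, (v (x i) ⬝ᵥ u) ^ 2 := by
  simp only [shrunk, sub_mulVec, one_mulVec, smul_mulVec, sum_mulVec, vecMulVec_mulVec,
    dotProduct_sub, dotProduct_smul, dotProduct_sum, op_smul_eq_smul, smul_eq_mul,
    dotProduct_comm u (v _), sq]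

lemma shrunk_cons (y : 𝓧) (x : Fin k → 𝓧) :
    shrunk v s (Fin.cons y x : Fin (k + 1) → 𝓧) = shrunk v s x - s • vecMulVec (v y) (v y) := by
  simp only [shrunk, Fin.sum_univ_succ, Fin.cons_zero, Fin.cons_succ, smul_add]
  abel

lemma dotProduct_sq_le (a b : Fin m → ℝ) : (a ⬝ᵥ b) ^ 2 ≤ (a ⬝ᵥ a) * (b ⬝ᵥ b) := by
  simpa [dotProduct, sq] using Finset.sum_mul_sq_le_sq_mul_sq Finset.univ a b

lemma dotProduct_self_nonneg_real (u : Fin m → ℝ) : 0 ≤ u ⬝ᵥ u :=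
  Finset.sum_nonneg fun _ _ => mul_self_nonneg _

variable {v s}

lemma shrunk_quadForm_ge {R : ℝ} (hs : 0 ≤ s) (hv : ∀ y, v y ⬝ᵥ v y ≤ R) (x : Fin k → 𝓧)
    (u : Fin m → ℝ) : (1 - s * k * R) * (u ⬝ᵥ u) ≤ u ⬝ᵥ shrunk v s x *ᵥ u := by
  have h : ∑ i, (v (x i) ⬝ᵥ u) ^ 2 ≤ ∑ _i : Fin k, R * (u ⬝ᵥ u) :=
    Finset.sum_le_sum fun i _ => (dotProduct_sq_le _ _).trans
      (mul_le_mul_of_nonneg_right (hv _) (dotProduct_self_nonneg_real u))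
  simp only [sum_const, card_univ, Fintype.card_fin, nsmul_eq_mul] at h
  rw [shrunk_quadForm]
  nlinarith

lemma shrunk_quadForm_le (hs : 0 ≤ s) (x : Fin k → 𝓧) (u : Fin m → ℝ) :
    u ⬝ᵥ shrunk v s x *ᵥ u ≤ u ⬝ᵥ u := by
  have h : 0 ≤ ∑ i, (v (x i) ⬝ᵥ u) ^ 2 := Finset.sum_nonneg fun i _ => sq_nonneg _
  rw [shrunk_quadForm]
  nlinarith

end Shrunk

lemma trace_pow_nonneg {m : ℕ} {M : Matrix (Fin m) (Fin m) ℝ} (hM : M.IsHermitian)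
    (hlow : ∀ u : Fin m → ℝ, 0 ≤ u ⬝ᵥ M *ᵥ u) (N : ℕ) : 0 ≤ (M ^ N).trace := by
  obtain ⟨l, U, -, h2, h3⟩ := exists_spectral_moments hM
  rw [h2]
  refine Finset.sum_nonneg fun a _ => pow_nonneg ?_ _
  obtain ⟨u, -, hu⟩ := h3 a
  exact hu ▸ hlow u

lemma trace_pow_succ_le {m : ℕ} {M : Matrix (Fin m) (Fin m) ℝ} (hM : M.IsHermitian)
    (hlow : ∀ u : Fin m → ℝ, 0 ≤ u ⬝ᵥ M *ᵥ u) (hup : ∀ u : Fin m → ℝ, u ⬝ᵥ M *ᵥ u ≤ u ⬝ᵥ u)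
    (N : ℕ) : (M ^ (N + 1)).trace ≤ (M ^ N).trace := by
  obtain ⟨l, U, -, h2, h3⟩ := exists_spectral_moments hM
  rw [h2, h2]
  refine Finset.sum_le_sum fun a _ => ?_
  obtain ⟨u, hu, hu'⟩ := h3 a
  have h0 := hlow u
  have h1 := hup u
  rw [hu'] at h0 h1
  exact pow_le_pow_of_le_one h0 (h1.trans_eq hu) (Nat.le_succ N)

lemma pow_le_trace_pow {m : ℕ} {M : Matrix (Fin m) (Fin m) ℝ} (hM : M.IsHermitian)
    (hlow : ∀ u : Fin m → ℝ, 0 ≤ u ⬝ᵥ M *ᵥ u) {b : ℝ} (hb : 0 ≤ b) {u : Fin m → ℝ}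
    (hu : b * (u ⬝ᵥ u) < u ⬝ᵥ M *ᵥ u) (N : ℕ) : b ^ N ≤ (M ^ N).trace := by
  obtain ⟨l, U, h1, h2, h3⟩ := exists_spectral_moments hM
  have hl : ∀ a, 0 ≤ l a := fun a => by
    obtain ⟨u, -, hu⟩ := h3 a
    exact hu ▸ hlow u
  obtain ⟨a, ha⟩ : ∃ a, b ≤ l a := by
    by_contra! hcon
    refine hu.not_ge ?_
    have e0 := h1 0 u
    have e1 := h1 1 u
    simp only [pow_zero, one_mulVec, mul_one, pow_one] at e0 e1
    rw [e0, e1, Finset.mul_sum]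
    refine Finset.sum_le_sum fun a _ => ?_
    nlinarith [hcon a, sq_nonneg ((U *ᵥ u) a)]
  rw [h2]
  exact (pow_le_pow_left₀ hb ha N).trans
    (Finset.single_le_sum (f := fun a => l a ^ N) (fun a _ => pow_nonneg (hl a) N) (mem_univ a))

lemma measurable_matrix_pow_apply {𝓨 : Type*} [MeasurableSpace 𝓨] {m : ℕ}
    {A : 𝓨 → Matrix (Fin m) (Fin m) ℝ} (hA : ∀ i j, Measurable fun y => A y i j) (N : ℕ)
    (i j : Fin m) : Measurable fun y => (A y ^ N) i j := by
  induction N generalizing i j with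
  | zero => simp
  | succ N ih =>
    simp only [pow_succ, Matrix.mul_apply]
    exact Finset.measurable_sum _ fun l _ => (ih i l).mul (hA l j)

lemma measurable_trace_shrunk_pow {𝓧 : Type*} [MeasurableSpace 𝓧] {m : ℕ}
    {v : 𝓧 → Fin m → ℝ} (hvm : ∀ i, Measurable fun y => v y i) (s : ℝ) (k N : ℕ) :
    Measurable fun x : Fin k → 𝓧 => (shrunk v s x ^ N).trace := by
  refine Finset.measurable_sum _ fun i _ => measurable_matrix_pow_apply (fun i j => ?_) N i i
  simp only [shrunk, Matrix.sub_apply, Matrix.smul_apply, Matrix.sum_apply, vecMulVec_apply,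
    smul_eq_mul]
  refine measurable_const.sub (measurable_const.mul (Finset.measurable_sum _ fun l _ => ?_))
  exact ((hvm i).comp (measurable_pi_apply l)).mul ((hvm j).comp (measurable_pi_apply l))

lemma quadForm_eq_sum {m : ℕ} (Q : Matrix (Fin m) (Fin m) ℝ) (u : Fin m → ℝ) :
    u ⬝ᵥ Q *ᵥ u = ∑ i, ∑ j, Q i j * (u i * u j) := by
  simp only [dotProduct, mulVec, Finset.mul_sum]
  exact Finset.sum_congr rfl fun i _ => Finset.sum_congr rfl fun j _ => by ring

section Chernoff

variable {𝓧 : Type*} [MeasurableSpace 𝓧] {m : ℕ} {ν : Measure 𝓧} [IsProbabilityMeasure ν]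
  {v : 𝓧 → Fin m → ℝ} {R : ℝ}

lemma integrable_mul_of_dotProduct_le (hvm : ∀ i, Measurable fun y => v y i)
    (hv : ∀ y, v y ⬝ᵥ v y ≤ R) (i j : Fin m) : Integrable (fun y => v y i * v y j) ν := by
  refine Integrable.of_bound ((hvm i).mul (hvm j)).aestronglyMeasurable R
    (Filter.Eventually.of_forall fun y => ?_)
  have h : ∀ i, v y i ^ 2 ≤ R := fun i => (hv y).trans' <| by
    rw [sq]
    exact Finset.single_le_sum (f := fun i => v y i * v y i) (fun a _ => mul_self_nonneg _)
      (mem_univ i)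
  rw [Real.norm_eq_abs, abs_le]
  constructor <;> nlinarith [h i, h j, sq_nonneg (v y i - v y j), sq_nonneg (v y i + v y j)]

lemma integrable_quadForm (hvm : ∀ i, Measurable fun y => v y i) (hv : ∀ y, v y ⬝ᵥ v y ≤ R)
    (Q : Matrix (Fin m) (Fin m) ℝ) : Integrable (fun y => v y ⬝ᵥ Q *ᵥ v y) ν := by
  simp only [quadForm_eq_sum]
  exact integrable_finsetSum _ fun i _ => integrable_finsetSum _ fun j _ =>
    (integrable_mul_of_dotProduct_le hvm hv i j).const_mul _

lemma integral_quadForm (hvm : ∀ i, Measurable fun y => v y i) (hv : ∀ y, v y ⬝ᵥ v y ≤ R)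
    (hiso : IsONB ν fun i y => v y i) (Q : Matrix (Fin m) (Fin m) ℝ) :
    ∫ y, v y ⬝ᵥ Q *ᵥ v y ∂ν = Q.trace := by
  have hint := fun i j => (integrable_mul_of_dotProduct_le (ν := ν) hvm hv i j).const_mul (Q i j)
  simp only [quadForm_eq_sum]
  rw [integral_finsetSum _ fun i _ => integrable_finsetSum _ fun j _ => hint i j]
  refine Finset.sum_congr rfl fun i _ => ?_
  rw [integral_finsetSum _ fun j _ => hint i j]
  simp [integral_const_mul, hiso i _]

lemma lintegral_trace_pow_sub_rankOne_le (hvm : ∀ i, Measurable fun y => v y i) (hR : 0 < R)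
    (hv : ∀ y, v y ⬝ᵥ v y ≤ R) (hiso : IsONB ν fun i y => v y i)
    {C : Matrix (Fin m) (Fin m) ℝ} (hC : C.IsHermitian) {s lo : ℝ} (hs : 0 ≤ s) (hlo : 0 < lo)
    (hlow : ∀ y, ∀ u : Fin m → ℝ, lo * (u ⬝ᵥ u) ≤ u ⬝ᵥ (C - s • vecMulVec (v y) (v y)) *ᵥ u)
    (hlow' : ∀ u : Fin m → ℝ, 0 ≤ u ⬝ᵥ C *ᵥ u)
    (hup : ∀ u : Fin m → ℝ, u ⬝ᵥ C *ᵥ u ≤ u ⬝ᵥ u) (p : ℕ) :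
    ∫⁻ y, ENNReal.ofReal ((C - s • vecMulVec (v y) (v y)) ^ (p + 1)).trace ∂ν ≤
      ENNReal.ofReal (Real.exp (-(lo / R * (1 - Real.exp (-((p + 1) * s * R / lo)))))) *
        ENNReal.ofReal (C ^ (p + 1)).trace := by
  set c := lo / R * (1 - Real.exp (-((p + 1) * s * R / lo))) with hc
  have hc0 : 0 ≤ c := by
    refine mul_nonneg (by positivity) (sub_nonneg.mpr (Real.exp_le_one_iff.mpr ?_))
    rw [neg_nonpos]
    positivity
  have hstep : ∀ y, ((C - s • vecMulVec (v y) (v y)) ^ (p + 1)).trace ≤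
      (C ^ (p + 1)).trace - c * (v y ⬝ᵥ (C ^ p) *ᵥ v y) := fun y =>
    trace_pow_sub_rankOne_le hC hlo hR hs (hlow y) (hv y) p
  have hnn : ∀ y, 0 ≤ ((C - s • vecMulVec (v y) (v y)) ^ (p + 1)).trace := by
    intro y
    refine trace_pow_nonneg (hC.sub ?_) (fun u => (hlow y u).trans' ?_) _
    · simp [Matrix.IsHermitian, conjTranspose_eq_transpose_of_trivial, transpose_smul,
        transpose_vecMulVec]
    · exact mul_nonneg hlo.le (dotProduct_self_nonneg_real u)
  have hint := (integrable_quadForm (ν := ν) hvm hv (C ^ p)).const_mul c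
  calc _ ≤ ∫⁻ y, ENNReal.ofReal ((C ^ (p + 1)).trace - c * (v y ⬝ᵥ (C ^ p) *ᵥ v y)) ∂ν :=
        lintegral_mono fun y => ENNReal.ofReal_le_ofReal (hstep y)
    _ = ENNReal.ofReal ((C ^ (p + 1)).trace - c * (C ^ p).trace) := by
        rw [← ofReal_integral_eq_lintegral_ofReal
          (f := fun y => (C ^ (p + 1)).trace - c * (v y ⬝ᵥ (C ^ p) *ᵥ v y))
          ((integrable_const _).sub hint) (Filter.Eventually.of_forall fun y => (hnn y).trans (hstep y)),
          integral_sub (integrable_const _) hint, integral_const_mul,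
          integral_quadForm hvm hv hiso]
        simp
    _ ≤ _ := by
        rw [← ENNReal.ofReal_mul (Real.exp_pos _).le]
        refine ENNReal.ofReal_le_ofReal ?_
        have h1 := trace_pow_succ_le hC hlow' hup p
        have h2 := trace_pow_nonneg hC hlow' (p + 1)
        have h3 := Real.add_one_le_exp (-c)
        nlinarith

lemma lintegral_trace_shrunk_pow_le (hvm : ∀ i, Measurable fun y => v y i) (hR : 0 < R)
    (hv : ∀ y, v y ⬝ᵥ v y ≤ R) (hiso : IsONB ν fun i y => v y i) {s lo : ℝ} (hs : 0 ≤ s)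
    (hlo : 0 < lo) (p k : ℕ) (hk : lo ≤ 1 - s * k * R) :
    ∫⁻ x, ENNReal.ofReal (shrunk v s x ^ (p + 1)).trace ∂(Measure.pi fun _ : Fin k => ν) ≤
      ENNReal.ofReal (Real.exp (-(lo / R * (1 - Real.exp (-((p + 1) * s * R / lo)))))) ^ k *
        ENNReal.ofReal m := by
  induction k with
  | zero => simp [shrunk]
  | succ k ih =>
    have hk' : lo ≤ 1 - s * k * R := by
      push_cast at hk
      nlinarith [mul_nonneg hs hR.le]
    have hmeas := (measurable_trace_shrunk_pow hvm s (k + 1) (p + 1)).ennreal_ofReal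
    have hmp := (measurePreserving_piFinSuccAbove (fun _ : Fin (k + 1) => ν) 0).symm
    rw [← hmp.lintegral_comp hmeas]
    have hcons : ∀ z : 𝓧 × (Fin k → 𝓧),
        (MeasurableEquiv.piFinSuccAbove (fun _ : Fin (k + 1) => 𝓧) 0).symm z =
          (Fin.cons z.1 z.2 : Fin (k + 1) → 𝓧) := fun z => by
      simp [MeasurableEquiv.piFinSuccAbove, Fin.insertNthEquiv]
    refine (lintegral_prod_symm _
      (hmeas.comp (MeasurableEquiv.measurable _)).aemeasurable).trans_le ?_
    simp only [Function.comp_apply, hcons, shrunk_cons]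
    rw [pow_succ', mul_assoc]
    refine le_trans ?_ (mul_le_mul_right (ih hk') _)
    rw [← lintegral_const_mul _ (measurable_trace_shrunk_pow hvm s k (p + 1)).ennreal_ofReal]
    refine lintegral_mono fun x => ?_
    refine lintegral_trace_pow_sub_rankOne_le hvm hR hv hiso (shrunk_isHermitian v s x) hs hlo
      (fun y u => ?_) (fun u => ?_) (fun u => shrunk_quadForm_le hs x u) p
    · rw [← shrunk_cons]
      exact (mul_le_mul_of_nonneg_right hk (dotProduct_self_nonneg_real u)).trans
        (shrunk_quadForm_ge hs hv _ u)
    · exact (mul_nonneg (hlo.le.trans hk') (dotProduct_self_nonneg_real u)).trans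
        (shrunk_quadForm_ge hs hv x u)

/-- Lower-tail matrix Chernoff bound for sums of i.i.d. isotropic rank-one matrices. -/
theorem measure_smallEigenvalue_le (hvm : ∀ i, Measurable fun y => v y i) (hR : 0 < R)
    (hv : ∀ y, v y ⬝ᵥ v y ≤ R) (hiso : IsONB ν fun i y => v y i) {δ : ℝ} (hδ0 : 0 < δ)
    (hδ1 : δ < 1) (n : ℕ) :
    (Measure.pi fun _ : Fin n => ν)
        {x | ¬ ∀ u : Fin m → ℝ, n * (1 - δ) * (u ⬝ᵥ u) ≤ ∑ i, (v (x i) ⬝ᵥ u) ^ 2} ≤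
      ENNReal.ofReal (m * Real.exp (-(n * cDelta δ / R))) := by
  set θ : ℝ := -Real.log (1 - δ) / R with hθ
  have hθ0 : 0 ≤ θ := div_nonneg (neg_nonneg.mpr (Real.log_nonpos (by linarith) (by linarith)))
    hR.le
  set lo : ℕ → ℝ := fun p => 1 - θ / (p + 1) * n * R with hlodef
  have hzero : Filter.Tendsto (fun p : ℕ => θ / ((p : ℝ) + 1)) Filter.atTop (nhds 0) := by
    simpa [div_eq_mul_inv] using (tendsto_one_div_add_atTop_nhds_zero_nat (𝕜 := ℝ)).const_mul θ
  have hlo : Filter.Tendsto lo Filter.atTop (nhds 1) := by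
    simpa using ((hzero.mul_const (n : ℝ)).mul_const R).const_sub 1
  set b : ℕ → ℝ := fun p => 1 + -(θ * n * (1 - δ)) / ((p + 1 : ℕ) : ℝ) with hbdef
  have hbpow : Filter.Tendsto (fun p => b p ^ (p + 1)) Filter.atTop
      (nhds (Real.exp (-(θ * n * (1 - δ))))) :=
    (Real.tendsto_one_add_div_pow_exp (-(θ * n * (1 - δ)))).comp (Filter.tendsto_add_atTop_nat 1)
  have hb : Filter.Tendsto b Filter.atTop (nhds 1) := by
    simpa [hbdef, div_eq_mul_inv, mul_assoc, mul_comm, mul_left_comm] using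
      ((hzero.mul_const (n * (1 - δ) : ℝ)).neg).const_add 1
  set c : ℕ → ℝ := fun p => lo p / R * (1 - Real.exp (-(θ * R / lo p))) with hcdef
  have hc : Filter.Tendsto c Filter.atTop (nhds (1 / R * (1 - Real.exp (-(θ * R / 1))))) := by
    refine (hlo.div_const R).mul (((Real.continuous_exp.tendsto _).comp ?_).const_sub 1)
    exact (tendsto_const_nhds.div hlo one_ne_zero).neg
  have hlim : Filter.Tendsto
      (fun p => ENNReal.ofReal (m * Real.exp (-c p) ^ n / b p ^ (p + 1))) Filter.atTop
      (nhds (ENNReal.ofReal (m * Real.exp (-(1 / R * (1 - Real.exp (-(θ * R / 1))))) ^ n /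
        Real.exp (-(θ * n * (1 - δ)))))) := by
    refine ENNReal.tendsto_ofReal (Filter.Tendsto.div ?_ hbpow (Real.exp_ne_zero _))
    exact (((Real.continuous_exp.tendsto _).comp hc.neg).pow n).const_mul _
  have hval : m * Real.exp (-(1 / R * (1 - Real.exp (-(θ * R / 1))))) ^ n /
      Real.exp (-(θ * n * (1 - δ))) = m * Real.exp (-(n * cDelta δ / R)) := by
    have h1 : -(θ * R / 1) = Real.log (1 - δ) := by
      rw [hθ]; field_simp
    rw [h1, Real.exp_log (by linarith), ← Real.exp_nat_mul, mul_div_assoc, ← Real.exp_sub]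
    congr 2
    rw [hθ, cDelta]
    field_simp
    ring
  rw [← hval]
  refine ge_of_tendsto hlim ?_
  filter_upwards [hlo.eventually_const_lt zero_lt_one, hb.eventually_const_lt zero_lt_one]
    with p hp hbp
  have hp1 : (0 : ℝ) < p + 1 := by positivity
  have hs : 0 ≤ θ / ((p : ℝ) + 1) := by positivity
  have hint := lintegral_trace_shrunk_pow_le hvm hR hv hiso hs hp p n le_rfl
  rw [mul_div_cancel₀ θ hp1.ne'] at hint
  change _ ≤ ENNReal.ofReal (Real.exp (-c p)) ^ n * ENNReal.ofReal m at hint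
  have hsub : {x : Fin n → 𝓧 | ¬ ∀ u : Fin m → ℝ,
        n * (1 - δ) * (u ⬝ᵥ u) ≤ ∑ i, (v (x i) ⬝ᵥ u) ^ 2} ⊆
      {x | ENNReal.ofReal (b p ^ (p + 1)) ≤
        ENNReal.ofReal (shrunk v (θ / (p + 1)) x ^ (p + 1)).trace} := by
    intro x hx
    simp only [Set.mem_ofPred_eq, not_forall, not_le] at hx ⊢
    obtain ⟨u, hu⟩ := hx
    have hθpos : 0 < θ := div_pos (neg_pos.mpr (Real.log_neg (by linarith) (by linarith))) hR
    refine ENNReal.ofReal_le_ofReal (pow_le_trace_pow (shrunk_isHermitian v _ x) (fun w => ?_)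
      hbp.le (u := u) ?_ _)
    · exact (mul_nonneg hp.le (dotProduct_self_nonneg_real w)).trans
        (shrunk_quadForm_ge hs hv x w)
    · rw [shrunk_quadForm]
      have h1 : b p * (u ⬝ᵥ u) = u ⬝ᵥ u - θ / (p + 1) * (n * (1 - δ) * (u ⬝ᵥ u)) := by
        simp only [hbdef]
        push_cast
        ring
      rw [h1]
      have := mul_lt_mul_of_pos_left hu (div_pos hθpos hp1)
      linarith
  refine (measure_mono hsub).trans ?_
  have hbN : 0 < b p ^ (p + 1) := pow_pos hbp _
  rw [ENNReal.ofReal_div_of_pos hbN, ENNReal.le_div_iff_mul_le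
    (Or.inl (ENNReal.ofReal_pos.mpr hbN).ne') (Or.inl ENNReal.ofReal_ne_top), mul_comm]
  refine (mul_meas_ge_le_lintegral
    (measurable_trace_shrunk_pow hvm _ n (p + 1)).ennreal_ofReal _).trans (hint.trans_eq ?_)
  rw [← ENNReal.ofReal_pow (Real.exp_pos _).le, mul_comm,
    ← ENNReal.ofReal_mul (Nat.cast_nonneg m)]
end Chernoff

section LeastSquares

variable {𝓧 : Type*} {m n : ℕ} (φ : Fin m → 𝓧 → ℝ) {w : 𝓧 → ℝ}

variable {φ} in
lemma wChr_nonneg (y : 𝓧) : 0 ≤ wChr φ y :=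
  mul_nonneg (by positivity) (Finset.sum_nonneg fun _ _ => sq_nonneg _)

lemma lin_apply (a : Fin m → ℝ) (y : 𝓧) : lin φ a y = feat φ y ⬝ᵥ a :=
  Finset.sum_congr rfl fun _ _ => mul_comm _ _

lemma lin_sub (a b : Fin m → ℝ) (y : 𝓧) : lin φ (a - b) y = lin φ a y - lin φ b y := by
  simp only [lin_apply, dotProduct_sub]

lemma gram_mulVec (x : Fin n → 𝓧) (u : Fin m → ℝ) :
    gram φ w x *ᵥ u = bVec φ w (lin φ u) x := by
  simp only [gram, bVec, smul_mulVec, sum_mulVec, vecMulVec_mulVec, op_smul_eq_smul, smul_smul,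
    lin_apply]

lemma dotProduct_bVec (x : Fin n → 𝓧) (u : Fin m → ℝ) (g : 𝓧 → ℝ) :
    u ⬝ᵥ bVec φ w g x = (n : ℝ)⁻¹ * ∑ i, (w (x i))⁻¹ * g (x i) * lin φ u (x i) := by
  rw [dotProduct_comm]
  simp only [bVec, smul_dotProduct, sum_dotProduct, smul_eq_mul, lin_apply]

lemma gram_quadForm (x : Fin n → 𝓧) (u : Fin m → ℝ) :
    u ⬝ᵥ gram φ w x *ᵥ u = empSq w (lin φ u) x := by
  rw [gram_mulVec, dotProduct_bVec, empSq]
  congr 1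
  exact Finset.sum_congr rfl fun _ _ => by ring

/-- Stability of least squares in the coefficients when the empirical Gram matrix is bounded
below. -/
lemma lsProj_coeff_stable (hw : ∀ y, 0 < w y) (x : Fin n → 𝓧) {β : ℝ} (hβ : 0 < β)
    (hG : ∀ u : Fin m → ℝ, β * (u ⬝ᵥ u) ≤ u ⬝ᵥ gram φ w x *ᵥ u) (f : 𝓧 → ℝ) (a : Fin m → ℝ) :
    β * ((a - (gram φ w x)⁻¹ *ᵥ bVec φ w f x) ⬝ᵥ (a - (gram φ w x)⁻¹ *ᵥ bVec φ w f x)) ≤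
      empSq w (fun y => f y - lin φ a y) x := by
  have hunit : IsUnit (gram φ w x) := by
    rw [← Matrix.mulVec_injective_iff_isUnit]
    intro u u' huu'
    have h1 := hG (u - u')
    rw [mulVec_sub, sub_eq_zero.mpr huu', dotProduct_zero] at h1
    have h2 : (u - u') ⬝ᵥ (u - u') = 0 :=
      le_antisymm (nonpos_of_mul_nonpos_right h1 hβ) (dotProduct_self_nonneg_real _)
    exact sub_eq_zero.mp (dotProduct_self_eq_zero.mp h2)
  set b := (gram φ w x)⁻¹ *ᵥ bVec φ w f x with hb
  have hGb : gram φ w x *ᵥ b = bVec φ w f x := by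
    rw [hb, mulVec_mulVec, Matrix.mul_nonsing_inv _ ((Matrix.isUnit_iff_isUnit_det _).mp hunit),
      one_mulVec]
  refine (hG _).trans ?_
  set d := a - b with hd
  have h1 : d ⬝ᵥ gram φ w x *ᵥ d =
      -((n : ℝ)⁻¹ * ∑ i, (w (x i))⁻¹ * (f (x i) - lin φ a (x i)) * lin φ d (x i)) := by
    rw [hd, mulVec_sub, ← hd, hGb, gram_mulVec, dotProduct_sub, dotProduct_bVec, dotProduct_bVec,
      ← mul_sub, ← Finset.sum_sub_distrib, ← mul_neg, ← Finset.sum_neg_distrib]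
    congr 1
    exact Finset.sum_congr rfl fun _ _ => by ring
  have h2 := gram_quadForm φ (w := w) x d
  have h3 : 0 ≤ empSq w (fun y => f y - lin φ a y + lin φ d y) x :=
    mul_nonneg (by positivity) (Finset.sum_nonneg fun i _ =>
      mul_nonneg (inv_nonneg.mpr (hw _).le) (sq_nonneg _))
  have h4 : empSq w (fun y => f y - lin φ a y + lin φ d y) x =
      empSq w (fun y => f y - lin φ a y) x + empSq w (lin φ d) x +
      2 * ((n : ℝ)⁻¹ * ∑ i, (w (x i))⁻¹ * (f (x i) - lin φ a (x i)) * lin φ d (x i)) := by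
    simp only [empSq]
    rw [mul_left_comm, ← mul_add, ← mul_add, ← Finset.sum_add_distrib, Finset.mul_sum (a := 2),
      ← Finset.sum_add_distrib]
    congr 1
    exact Finset.sum_congr rfl fun _ _ => by ring
  linarith

end LeastSquares

section L2

variable {𝓧 : Type*} [MeasurableSpace 𝓧] {μ : Measure 𝓧}

lemma l2_eq_toReal_eLpNorm {u : 𝓧 → ℝ} (hu : MemLp u 2 μ) :
    l2 μ u = (eLpNorm u 2 μ).toReal := by
  rw [hu.eLpNorm_eq_integral_rpow_norm two_ne_zero ENNReal.ofNat_ne_top,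
    ENNReal.toReal_ofReal (by positivity), l2, l2Sq, Real.sqrt_eq_rpow]
  simp

lemma l2_add_le {u v : 𝓧 → ℝ} (hu : MemLp u 2 μ) (hv : MemLp v 2 μ) :
    l2 μ (fun y => u y + v y) ≤ l2 μ u + l2 μ v := by
  have h := eLpNorm_add_le hu.aestronglyMeasurable hv.aestronglyMeasurable one_le_two
  change l2 μ (u + v) ≤ _
  rw [l2_eq_toReal_eLpNorm hu, l2_eq_toReal_eLpNorm hv, l2_eq_toReal_eLpNorm (hu.add hv),
    ← ENNReal.toReal_add hu.eLpNorm_ne_top hv.eLpNorm_ne_top]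
  exact ENNReal.toReal_mono (ENNReal.add_ne_top.mpr ⟨hu.eLpNorm_ne_top, hv.eLpNorm_ne_top⟩) h

variable {m : ℕ} {φ : Fin m → 𝓧 → ℝ}

lemma IsONB.memLp (hφ : ∀ j, Measurable (φ j)) (horth : IsONB μ φ) (j : Fin m) :
    MemLp (φ j) 2 μ := by
  rw [memLp_two_iff_integrable_sq (hφ j).aestronglyMeasurable]
  refine (Integrable.of_integral_ne_zero (f := fun y => φ j y * φ j y) ?_).congr
    (Filter.Eventually.of_forall fun y => (sq _).symm)
  rw [horth j j]
  simp

lemma IsONB.memLp_lin (hφ : ∀ j, Measurable (φ j)) (horth : IsONB μ φ) (a : Fin m → ℝ) :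
    MemLp (lin φ a) 2 μ :=
  memLp_finsetSum _ fun j _ => (horth.memLp hφ j).const_mul (a j)

lemma IsONB.l2_lin (hφ : ∀ j, Measurable (φ j)) (horth : IsONB μ φ) (a : Fin m → ℝ) :
    l2 μ (lin φ a) = Real.sqrt (a ⬝ᵥ a) := by
  have hint : ∀ i j, Integrable (fun y => a i * a j * (φ i y * φ j y)) μ := fun i j =>
    ((horth.memLp hφ i).integrable_mul (horth.memLp hφ j)).const_mul _
  have h : ∀ y, lin φ a y ^ 2 = ∑ i, ∑ j, a i * a j * (φ i y * φ j y) := by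
    intro y
    rw [sq, lin, Finset.sum_mul_sum]
    exact Finset.sum_congr rfl fun i _ => Finset.sum_congr rfl fun j _ => by ring
  rw [l2, l2Sq]
  congr 1
  simp only [h]
  rw [integral_finsetSum _ fun i _ => integrable_finsetSum _ fun j _ => hint i j]
  refine Finset.sum_congr rfl fun i _ => ?_
  rw [integral_finsetSum _ fun j _ => hint i j]
  simp [integral_const_mul, horth i _]

lemma integrable_wChr (hφ : ∀ j, Measurable (φ j)) (horth : IsONB μ φ) :
    Integrable (wChr φ) μ :=
  (integrable_finsetSum _ fun j _ => (horth.memLp hφ j).integrable_sq).const_mul _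

lemma integral_wChr (hm : 0 < m) (hφ : ∀ j, Measurable (φ j)) (horth : IsONB μ φ) :
    ∫ y, wChr φ y ∂μ = 1 := by
  have h : ∀ j, ∫ y, φ j y ^ 2 ∂μ = 1 := fun j => by simpa [sq] using horth j j
  simp only [wChr]
  rw [integral_const_mul, integral_finsetSum _ fun j _ => (horth.memLp hφ j).integrable_sq]
  simp only [h, sum_const, card_univ, Fintype.card_fin, nsmul_eq_mul, mul_one]
  exact inv_mul_cancel₀ (by positivity)

lemma isProbabilityMeasure_dens {w : 𝓧 → ℝ} (hw : ∀ y, 0 ≤ w y) (hint : Integrable w μ)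
    (h1 : ∫ y, w y ∂μ = 1) : IsProbabilityMeasure (dens μ w) := by
  constructor
  rw [dens, withDensity_apply _ MeasurableSet.univ, Measure.restrict_univ,
    ← ofReal_integral_eq_lintegral_ofReal hint (Filter.Eventually.of_forall hw), h1,
    ENNReal.ofReal_one]

lemma integral_dens {w : 𝓧 → ℝ} (hwm : Measurable w) (hw : ∀ y, 0 ≤ w y) (g : 𝓧 → ℝ) :
    ∫ y, g y ∂(dens μ w) = ∫ y, w y * g y ∂μ := by
  rw [dens, integral_withDensity_eq_integral_toReal_smul hwm.ennreal_ofReal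
    (Filter.Eventually.of_forall fun _ => ENNReal.ofReal_lt_top)]
  simp [ENNReal.toReal_ofReal (hw _)]

end L2

lemma cDelta_pos {δ : ℝ} (hδ0 : 0 < δ) (hδ1 : δ < 1) : 0 < cDelta δ := by
  have h0 : 0 < 1 - δ := by linarith
  have h := Real.log_lt_sub_one_of_pos (inv_pos.mpr h0) fun h1 => by
    linarith [inv_eq_one.mp h1]
  rw [Real.log_inv, ← mul_lt_mul_iff_right₀ h0, mul_sub, mul_inv_cancel₀ h0.ne'] at h
  rw [cDelta]
  linarith

end WLSDPP

open WLSDPP in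
/-- `H → L²_μ` quasi-optimality in probability for i.i.d. sampling from the
mixture density `w = α w_m + (1−α) h`. -/
theorem statement6 {𝓧 : Type*} [MeasurableSpace 𝓧] {m n : ℕ} (hm : 0 < m) (hn : 0 < n)
    (μ : Measure 𝓧) [IsProbabilityMeasure μ]
    (φ : Fin m → 𝓧 → ℝ) (hφ : ∀ j, Measurable (φ j)) (horth : IsONB μ φ)
    (h : 𝓧 → ℝ) (hhpos : ∀ x, 0 < h x) (hh : Measurable h) (hhint : ∫ y, h y ∂μ = 1)
    (H : Submodule ℝ (𝓧 → ℝ)) (normH : (𝓧 → ℝ) → ℝ) (C_H : ℝ)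
    (hemb : ∀ g ∈ H, l2 μ g ≤ C_H * normH g)
    (hsup : ∀ g ∈ H, ∀ x, |g x| ≤ Real.sqrt (h x) * normH g)
    (hVH : ∀ a : Fin m → ℝ, lin φ a ∈ H)
    (f : 𝓧 → ℝ) (hfH : f ∈ H) (hfmeas : Measurable f)
    {α : ℝ} (hα0 : 0 < α) (hα1 : α < 1)
    (w : 𝓧 → ℝ) (hw : w = fun x => α * wChr φ x + (1 - α) * h x)
    (P : Measure (Fin n → 𝓧)) (hP : P = Measure.pi fun _ : Fin n => dens μ w)
    {δ η : ℝ} (hδ0 : 0 < δ) (hδ1 : δ < 1) (hη0 : 0 < η) (hη1 : η < 1)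
    (hnm : (n : ℝ) ≥ (cDelta δ)⁻¹ * α⁻¹ * m * Real.log ((m : ℝ) * η⁻¹)) :
    ENNReal.ofReal (1 - η) ≤
      P {x | l2 μ (fun y => f y - lsProj φ w f x y)
              ≤ (C_H + Real.sqrt (1 - δ)⁻¹ * Real.sqrt (1 - α)⁻¹) *
                  ⨅ a : Fin m → ℝ, normH (fun y => f y - lin φ a y)} := by
  have hm' : (0 : ℝ) < m := Nat.cast_pos.mpr hm
  have hn' : (0 : ℝ) < n := Nat.cast_pos.mpr hn
  have hα : 0 < 1 - α := sub_pos.mpr hα1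
  have hδ : 0 < 1 - δ := sub_pos.mpr hδ1
  have hwval : ∀ y, w y = α * wChr φ y + (1 - α) * h y := fun y => congrFun hw y
  have hwh : ∀ y, (1 - α) * h y ≤ w y := fun y => by
    rw [hwval]
    exact le_add_of_nonneg_left (mul_nonneg hα0.le (wChr_nonneg y))
  have hwpos : ∀ y, 0 < w y := fun y => (mul_pos hα (hhpos y)).trans_le (hwh y)
  have hwm : Measurable w := by
    rw [hw]
    exact ((((Finset.measurable_sum _ fun j _ => (hφ j).pow_const 2).const_mul _).const_mul _).add
      (hh.const_mul _))
  have hhi : Integrable h μ := Integrable.of_integral_ne_zero (by rw [hhint]; exact one_ne_zero)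
  have hwi : Integrable w μ := by
    rw [hw]
    exact ((integrable_wChr hφ horth).const_mul α).add (hhi.const_mul (1 - α))
  have hw1 : ∫ y, w y ∂μ = 1 := by
    rw [hw, integral_add ((integrable_wChr hφ horth).const_mul α) (hhi.const_mul (1 - α)),
      integral_const_mul, integral_const_mul, integral_wChr hm hφ horth, hhint]
    ring
  have hprob : IsProbabilityMeasure (dens μ w) :=
    isProbabilityMeasure_dens (fun y => (hwpos y).le) hwi hw1
  have hPprob : IsProbabilityMeasure P := by rw [hP]; infer_instance
  set v : 𝓧 → Fin m → ℝ := fun y i => (Real.sqrt (w y))⁻¹ * φ i y with hv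
  have hvsq : ∀ y, (Real.sqrt (w y))⁻¹ ^ 2 = (w y)⁻¹ := fun y => by
    rw [inv_pow, Real.sq_sqrt (hwpos y).le]
  have hvm : ∀ i, Measurable fun y => v y i := fun i => hwm.sqrt.inv.mul (hφ i)
  have hR : 0 < m / α := div_pos hm' hα0
  have hvR : ∀ y, v y ⬝ᵥ v y ≤ m / α := fun y => by
    have h1 : v y ⬝ᵥ v y = (w y)⁻¹ * (m * wChr φ y) := by
      rw [wChr, mul_inv_cancel_left₀ hm'.ne', ← hvsq, Finset.mul_sum]
      exact Finset.sum_congr rfl fun i _ => by simp only [hv]; ring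
    rw [h1, inv_mul_eq_div, div_le_div_iff₀ (hwpos y) hα0]
    have := hwval y
    nlinarith [mul_pos hα (hhpos y)]
  have hiso : IsONB (dens μ w) fun i y => v y i := fun i j => by
    rw [integral_dens hwm fun y => (hwpos y).le, ← horth i j]
    refine integral_congr_ae (Filter.Eventually.of_forall fun y => ?_)
    change w y * ((Real.sqrt (w y))⁻¹ * φ i y * ((Real.sqrt (w y))⁻¹ * φ j y)) = _
    have : w y * (Real.sqrt (w y))⁻¹ ^ 2 = 1 := by
      rw [hvsq, mul_inv_cancel₀ (hwpos y).ne']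
    linear_combination φ i y * φ j y * this
  have hbad := measure_smallEigenvalue_le (ν := dens μ w) hvm hR hvR hiso hδ0 hδ1 n
  rw [← hP] at hbad
  have hη : m * Real.exp (-(n * cDelta δ / (m / α))) ≤ η := by
    have hc := cDelta_pos hδ0 hδ1
    have h1 : Real.log (m * η⁻¹) ≤ n * cDelta δ / (m / α) := by
      rw [le_div_iff₀ hR]
      have := mul_le_mul_of_nonneg_right hnm hc.le
      refine le_of_eq_of_le ?_ this
      field_simp
    calc m * Real.exp (-(n * cDelta δ / (m / α))) ≤ m * Real.exp (-Real.log (m * η⁻¹)) := by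
          gcongr
      _ = η := by
          rw [Real.exp_neg, Real.exp_log (by positivity)]
          field_simp
  have hgood : ∀ x : Fin n → 𝓧,
      (∀ u : Fin m → ℝ, n * (1 - δ) * (u ⬝ᵥ u) ≤ ∑ i, (v (x i) ⬝ᵥ u) ^ 2) →
      ∀ u : Fin m → ℝ, (1 - δ) * (u ⬝ᵥ u) ≤ u ⬝ᵥ gram φ w x *ᵥ u := by
    intro x hx u
    have h1 : ∑ i, (v (x i) ⬝ᵥ u) ^ 2 = ∑ i, (w (x i))⁻¹ * lin φ u (x i) ^ 2 := by
      refine Finset.sum_congr rfl fun i _ => ?_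
      have : v (x i) = (Real.sqrt (w (x i)))⁻¹ • feat φ (x i) := rfl
      rw [this, smul_dotProduct, smul_eq_mul, mul_pow, hvsq, lin_apply]
    rw [gram_quadForm, empSq, ← h1, inv_mul_eq_div, le_div_iff₀ hn']
    linarith [hx u]
  obtain ⟨y₀⟩ : Nonempty 𝓧 := μ.nonempty_of_neZero
  have hnorm0 : ∀ g ∈ H, 0 ≤ normH g := fun g hg =>
    nonneg_of_mul_nonneg_right ((abs_nonneg _).trans (hsup g hg y₀))
      (Real.sqrt_pos.mpr (hhpos y₀))
  have hCH : 0 ≤ C_H := by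
    by_contra! hneg
    have h1 := hemb _ (hVH (Pi.single ⟨0, hm⟩ 1))
    rw [horth.l2_lin hφ] at h1
    have h2 := hnorm0 _ (hVH (Pi.single ⟨0, hm⟩ 1))
    simp at h1
    nlinarith
  have hmain : ∀ x : Fin n → 𝓧,
      (∀ u : Fin m → ℝ, n * (1 - δ) * (u ⬝ᵥ u) ≤ ∑ i, (v (x i) ⬝ᵥ u) ^ 2) →
      l2 μ (fun y => f y - lsProj φ w f x y) ≤
        (C_H + Real.sqrt (1 - δ)⁻¹ * Real.sqrt (1 - α)⁻¹) *
          ⨅ a : Fin m → ℝ, normH (fun y => f y - lin φ a y) := by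
    intro x hx
    rw [Real.mul_iInf_of_nonneg (by positivity)]
    refine le_ciInf fun a => ?_
    have hgH : (fun y => f y - lin φ a y) ∈ H := H.sub_mem hfH (hVH a)
    set g : 𝓧 → ℝ := fun y => f y - lin φ a y with hg
    have hg0 := hnorm0 g hgH
    have hgsq : ∀ y, g y ^ 2 ≤ h y * normH g ^ 2 := fun y => by
      have := pow_le_pow_left₀ (abs_nonneg _) (hsup g hgH y) 2
      rwa [sq_abs, mul_pow, Real.sq_sqrt (hhpos y).le] at this
    have hgm : Measurable g :=
      hfmeas.sub (Finset.measurable_sum _ fun j _ => (hφ j).const_mul (a j))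
    have hgLp : MemLp g 2 μ := by
      rw [memLp_two_iff_integrable_sq hgm.aestronglyMeasurable]
      refine (hhi.mul_const (normH g ^ 2)).mono' (hgm.pow_const 2).aestronglyMeasurable
        (Filter.Eventually.of_forall fun y => ?_)
      rw [Real.norm_of_nonneg (sq_nonneg _)]
      exact hgsq y
    set d := a - (gram φ w x)⁻¹ *ᵥ bVec φ w f x with hd
    have hsplit : (fun y => f y - lsProj φ w f x y) = fun y => g y + lin φ d y := by
      funext y
      rw [hd, lin_sub, hg, lsProj]
      ring
    have hemp : empSq w g x ≤ (1 - α)⁻¹ * normH g ^ 2 := by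
      have h1 : ∀ y, (w y)⁻¹ * g y ^ 2 ≤ (1 - α)⁻¹ * normH g ^ 2 := fun y => by
        rw [inv_mul_eq_div, inv_mul_eq_div, div_le_div_iff₀ (hwpos y) hα]
        nlinarith [hgsq y, hwh y, sq_nonneg (normH g)]
      have h2 : ∑ i, (w (x i))⁻¹ * g (x i) ^ 2 ≤ ∑ _i : Fin n, (1 - α)⁻¹ * normH g ^ 2 :=
        Finset.sum_le_sum fun i _ => h1 _
      simp only [sum_const, card_univ, Fintype.card_fin, nsmul_eq_mul] at h2
      rw [empSq, inv_mul_le_iff₀ hn']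
      exact h2
    have hdd : d ⬝ᵥ d ≤ (1 - δ)⁻¹ * ((1 - α)⁻¹ * normH g ^ 2) := by
      rw [le_inv_mul_iff₀ hδ]
      exact (lsProj_coeff_stable φ hwpos x hδ (hgood x hx) f a).trans hemp
    have hlin : l2 μ (lin φ d) ≤ Real.sqrt (1 - δ)⁻¹ * Real.sqrt (1 - α)⁻¹ * normH g := by
      rw [horth.l2_lin hφ]
      refine (Real.sqrt_le_sqrt hdd).trans_eq ?_
      rw [Real.sqrt_mul (by positivity), Real.sqrt_mul (by positivity), Real.sqrt_sq hg0,
        mul_assoc]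
    rw [hsplit, add_mul]
    exact (l2_add_le hgLp (horth.memLp_lin hφ d)).trans (add_le_add (hemb g hgH) hlin)
  have hcover : (1 : ℝ≥0∞) ≤ P {x | l2 μ (fun y => f y - lsProj φ w f x y)
              ≤ (C_H + Real.sqrt (1 - δ)⁻¹ * Real.sqrt (1 - α)⁻¹) *
                  ⨅ a : Fin m → ℝ, normH (fun y => f y - lin φ a y)} + ENNReal.ofReal η := by
    rw [← measure_univ (μ := P)]
    refine (measure_mono fun x _ => ?_).trans ((measure_union_le _ _).trans
      (add_le_add le_rfl (hbad.trans (ENNReal.ofReal_le_ofReal hη))))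
    by_cases hx : ∀ u : Fin m → ℝ, n * (1 - δ) * (u ⬝ᵥ u) ≤ ∑ i, (v (x i) ⬝ᵥ u) ^ 2
    · exact Or.inl (hmain x hx)
    · exact Or.inr hx
  rw [ENNReal.ofReal_sub _ hη0.le, ENNReal.ofReal_one]
  exact tsub_le_iff_right.mpr hcover
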